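/- arXiv:1709.02115 — 4 statements merged into one kernel-verified Lean document; each statement's English description precedes it below -/
import Mathlib

section
/- Let d ≥ 1 and let G : ℝ^d → ℝ^d be continuously differentiable. Assume that ‖G(z)‖ → ∞ as ‖z‖ → ∞ and that det(DG(z)) ≠ 0 for every z ∈ ℝ^d, where DG(z) denotes the total derivative of G at z. Then G is a diffeomorphism of ℝ^d: G is bijective and its inverse G⁻¹ is continuously differentiable. -/
/-- A covering map from a nonempty preconnected space to a simply connected, locally path
connected space is bijective. -/
theorem IsCoveringMap.bijective_of_simplyConnectedSpace {E X : Type*} [TopologicalSpace E]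
    [TopologicalSpace X] [PreconnectedSpace E] [Nonempty E] [SimplyConnectedSpace X]
    [LocallyPathConnectedSpace X] {p : E → X} (hp : IsCoveringMap p) : Function.Bijective p := by
  obtain ⟨a⟩ := ‹Nonempty E›
  obtain ⟨F, ⟨hFa, hpF⟩, -⟩ :=
    hp.existsUnique_continuousMap_lifts (ContinuousMap.id X) (p a) a rfl
  have hFp : F ∘ p = id :=
    hp.eq_of_comp_eq (F.continuous.comp hp.continuous) continuous_id
      (by rw [← Function.comp_assoc, hpF]; rfl) a hFa
  exact ⟨Function.LeftInverse.injective (congrFun hFp), fun x ↦ ⟨F x, congrFun hpF x⟩⟩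

/-- A proper local homeomorphism from a Hausdorff space is a covering map. -/
theorem IsProperMap.isCoveringMap_of_isLocalHomeomorph {E X : Type*} [TopologicalSpace E]
    [TopologicalSpace X] [T2Space E] {f : E → X} (hf : IsProperMap f)
    (h : IsLocalHomeomorph f) : IsCoveringMap f := by
  rw [isCoveringMap_iff_isCoveringMapOn_univ]
  refine hf.isClosedMap.isCoveringMapOn_of_isLocalHomeomorphOn (fun x _ ↦ ?_) fun e _ ↦ h e
  refine (hf.isCompact_preimage isCompact_singleton).finite
    (.of_openPartialHomeomorph f subset_rfl fun e _ ↦ ?_)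
  obtain ⟨φ, he, rfl⟩ := h e
  exact ⟨φ, he, rfl⟩

/-- **Hadamard global inverse theorem.** If `G : ℝ^d → ℝ^d` is continuously
differentiable, `‖G z‖ → ∞` as `‖z‖ → ∞`, and the determinant of the total
derivative `DG z` is nonzero for every `z`, then `G` is a diffeomorphism of
`ℝ^d`: it is bijective with continuously differentiable inverse. -/
theorem stmt_0 (d : ℕ) (hd : 1 ≤ d)
    (G : EuclideanSpace ℝ (Fin d) → EuclideanSpace ℝ (Fin d))
    (hG : ContDiff ℝ 1 G)
    (hinf : Filter.Tendsto (fun z => ‖G z‖) (Filter.cocompact (EuclideanSpace ℝ (Fin d)))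
      Filter.atTop)
    (hdet : ∀ z, LinearMap.det
      ((fderiv ℝ G z : EuclideanSpace ℝ (Fin d) →L[ℝ] EuclideanSpace ℝ (Fin d)) :
        EuclideanSpace ℝ (Fin d) →ₗ[ℝ] EuclideanSpace ℝ (Fin d)) ≠ 0) :
    Function.Bijective G ∧ ContDiff ℝ 1 (Function.invFun G) := by
  have hstrict (z) : HasStrictFDerivAt G
      ((fderiv ℝ G z).toContinuousLinearEquivOfDetNeZero (hdet z) : _ →L[ℝ] _) z := by
    simpa using hG.hasStrictFDerivAt one_ne_zero
  have hloc : IsLocalHomeomorph G := fun z ↦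
    ⟨(hstrict z).toOpenPartialHomeomorph G, (hstrict z).mem_toOpenPartialHomeomorph_source, rfl⟩
  have hproper : IsProperMap G := isProperMap_iff_tendsto_cocompact.mpr
    ⟨hG.continuous, by rwa [← Metric.cobounded_eq_cocompact, ← tendsto_norm_atTop_iff_cobounded,
      Metric.cobounded_eq_cocompact]⟩
  have hbij : Function.Bijective G :=
    (hproper.isCoveringMap_of_isLocalHomeomorph hloc).bijective_of_simplyConnectedSpace
  refine ⟨hbij, ?_⟩
  have hinv : Function.invFun G = (hloc.toHomeomorphOfBijective hbij).symm := by
    funext y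
    exact hbij.injective ((Function.rightInverse_invFun hbij.surjective y).trans
      ((hloc.toHomeomorphOfBijective hbij).apply_symm_apply y).symm)
  rw [hinv]
  exact (hloc.toHomeomorphOfBijective hbij).contDiff_symm
    (fun z ↦ (hstrict z).hasFDerivAt) hG
end

section
/- Let 0 ≤ s ≤ T, let B : [0,T] → ℝ be continuous, let f : ℝ → ℝ be continuously differentiable, and let x, y ∈ ℝ. Suppose X, Y : [s,T] → ℝ are continuous and satisfy, for all t ∈ [s,T], X_t = x + ∫_s^t f(X_r) dr + (B_t − B_s) and Y_t = y + ∫_s^t f(Y_r) dr + (B_t − B_s). Then for all t ∈ [s,T], X_t − Y_t = (x − y) · exp( ∫_s^t ∫₀¹ f'(u X_r + (1−u) Y_r) du dr ). -/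
/-- Variation of constants for the scalar linear integral equation. -/
theorem eq_mul_exp_of_eq_add_integral_mul {s T c : ℝ} {a D : ℝ → ℝ}
    (ha : Continuous a) (hD : Continuous D)
    (h : ∀ t ∈ Set.Icc s T, D t = c + ∫ r in s..t, a r * D r) :
    ∀ t ∈ Set.Icc s T, D t = c * Real.exp (∫ r in s..t, a r) := by
  set E : ℝ → ℝ := fun t => c + ∫ r in s..t, a r * D r with hE
  set A : ℝ → ℝ := fun t => ∫ r in s..t, a r with hA
  have hE' (t : ℝ) : HasDerivAt E (a t * D t) t :=
    ((ha.mul hD).integral_hasStrictDerivAt s t).hasDerivAt.const_add c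
  have hA' (t : ℝ) : HasDerivAt A (a t) t :=
    (ha.integral_hasStrictDerivAt s t).hasDerivAt
  have hG (t : ℝ) : HasDerivAt (fun t => E t * Real.exp (-A t))
      (a t * D t * Real.exp (-A t) + E t * (Real.exp (-A t) * -a t)) t :=
    (hE' t).mul (hA' t).neg.exp
  have hconst := constant_of_has_deriv_right_zero (a := s) (b := T)
    (fun t _ => (hG t).continuousAt.continuousWithinAt) (fun t ht => by
      have hDt : D t = E t := h t (Set.Ico_subset_Icc_self ht)
      convert (hG t).hasDerivWithinAt using 1
      rw [hDt]
      ring)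
  intro t ht
  have ht' : E t * Real.exp (-A t) = c := by simpa [hE, hA] using hconst t ht
  calc D t = E t := h t ht
    _ = E t * (Real.exp (-A t) * Real.exp (A t)) := by rw [← Real.exp_add]; simp
    _ = c * Real.exp (A t) := by rw [← mul_assoc, ht']

/-- Hadamard's lemma on the line: an increment is the averaged derivative times the step. -/
theorem ContDiff.sub_eq_integral_deriv_mul {f : ℝ → ℝ} (hf : ContDiff ℝ 1 f) (p q : ℝ) :
    f p - f q = (∫ u in (0:ℝ)..1, deriv f (u * p + (1 - u) * q)) * (p - q) := by
  have hd : Continuous (deriv f) := hf.continuous_deriv le_rfl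
  have hderiv (u : ℝ) : HasDerivAt (fun u : ℝ => f (u * p + (1 - u) * q))
      (deriv f (u * p + (1 - u) * q) * (p - q)) u := by
    refine HasDerivAt.comp u
      (hf.differentiable one_ne_zero (u * p + (1 - u) * q)).hasDerivAt ?_
    exact (((hasDerivAt_id u).mul_const p).add
      (((hasDerivAt_id u).const_sub 1).mul_const q)).congr_deriv (by ring)
  have hint := intervalIntegral.integral_eq_sub_of_hasDerivAt (a := 0) (b := 1)
    (fun u _ => hderiv u) (Continuous.intervalIntegrable (by fun_prop) _ _)
  rw [intervalIntegral.integral_mul_const] at hint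
  rw [hint]
  simp

/-- Let `0 ≤ s ≤ T`, `B : [0,T] → ℝ` continuous, `f : ℝ → ℝ` continuously
differentiable, `x, y ∈ ℝ`. If `X, Y : [s,T] → ℝ` are continuous and satisfy
`X_t = x + ∫_s^t f(X_r) dr + (B_t − B_s)` and
`Y_t = y + ∫_s^t f(Y_r) dr + (B_t − B_s)` on `[s,T]`, then for all `t ∈ [s,T]`,
`X_t − Y_t = (x − y) exp(∫_s^t ∫₀¹ f'(u X_r + (1−u) Y_r) du dr)`. -/
theorem stmt_8 (s T : ℝ) (hs : 0 ≤ s) (hsT : s ≤ T)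
    (B : ℝ → ℝ) (hB : ContinuousOn B (Set.Icc 0 T))
    (f : ℝ → ℝ) (hf : ContDiff ℝ 1 f) (x y : ℝ)
    (X Y : ℝ → ℝ)
    (hX : ContinuousOn X (Set.Icc s T)) (hY : ContinuousOn Y (Set.Icc s T))
    (hXeq : ∀ t ∈ Set.Icc s T, X t = x + (∫ r in s..t, f (X r)) + (B t - B s))
    (hYeq : ∀ t ∈ Set.Icc s T, Y t = y + (∫ r in s..t, f (Y r)) + (B t - B s)) :
    ∀ t ∈ Set.Icc s T,
      X t - Y t = (x - y) *
        Real.exp (∫ r in s..t, ∫ u in (0:ℝ)..1, deriv f (u * X r + (1 - u) * Y r)) := by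
  have hd : Continuous (deriv f) := hf.continuous_deriv le_rfl
  set X' : ℝ → ℝ := Set.IccExtend hsT (Set.domRestrict (Set.Icc s T) X) with hX'
  set Y' : ℝ → ℝ := Set.IccExtend hsT (Set.domRestrict (Set.Icc s T) Y) with hY'
  have cX : Continuous X' := hX.domRestrict.Icc_extend'
  have cY : Continuous Y' := hY.domRestrict.Icc_extend'
  have eX : ∀ t ∈ Set.Icc s T, X' t = X t := fun t ht => by
    rw [hX', Set.IccExtend_of_mem hsT _ ht, Set.domRestrict_apply]
  have eY : ∀ t ∈ Set.Icc s T, Y' t = Y t := fun t ht => by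
    rw [hY', Set.IccExtend_of_mem hsT _ ht, Set.domRestrict_apply]
  have hsub : ∀ t ∈ Set.Icc s T, Set.uIcc s t ⊆ Set.Icc s T := fun t ht => by
    rw [Set.uIcc_of_le ht.1]
    exact Set.Icc_subset_Icc_right ht.2
  have ca : Continuous fun r => ∫ u in (0:ℝ)..1, deriv f (u * X' r + (1 - u) * Y' r) :=
    intervalIntegral.continuous_parametric_intervalIntegral_of_continuous' (by fun_prop) 0 1
  have key := eq_mul_exp_of_eq_add_integral_mul (s := s) (T := T) (c := x - y) ca (cX.sub cY)
    (fun t ht => by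
      have iX : ∫ r in s..t, f (X r) = ∫ r in s..t, f (X' r) :=
        intervalIntegral.integral_congr fun r hr => by simp only [eX r (hsub t ht hr)]
      have iY : ∫ r in s..t, f (Y r) = ∫ r in s..t, f (Y' r) :=
        intervalIntegral.integral_congr fun r hr => by simp only [eY r (hsub t ht hr)]
      simp only [Pi.sub_apply, ← hf.sub_eq_integral_deriv_mul]
      rw [intervalIntegral.integral_sub
        ((hf.continuous.comp' cX).intervalIntegrable _ _)
        ((hf.continuous.comp' cY).intervalIntegrable _ _),
        eX t ht, eY t ht, hXeq t ht, hYeq t ht, iX, iY]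
      ring)
  intro t ht
  have hkey := key t ht
  rw [Pi.sub_apply, eX t ht, eY t ht] at hkey
  rw [hkey]
  congr 2
  refine intervalIntegral.integral_congr fun r hr => ?_
  simp only [eX r (hsub t ht hr), eY r (hsub t ht hr)]
end

section
/- Let d ≥ 1, T > 0, 1/3 < β < 1/2, and let f : ℝ^d → ℝ^d be bounded and continuous. Let Y, Y¹, Y², … : [0,T] → ℝ^d be continuous functions such that Yⁿ_r → Y_r as n → ∞ for every r ∈ [0,T]. Then sup_{0 ≤ s < t ≤ T} ‖∫_s^t ( f(Yⁿ_r) − f(Y_r) ) dr‖ / (t−s)^{2β} → 0 as n → ∞. -/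
open Filter

/-- Interpolation between the Lipschitz bound `K (t - s)` and the `L¹` bound on an integral. -/
theorem norm_integral_div_rpow_le {E : Type*} [NormedAddCommGroup E] [NormedSpace ℝ E]
    {g : ℝ → E} {T K α s t : ℝ} (hα0 : 0 ≤ α) (hα1 : α ≤ 1) (hK : 0 ≤ K)
    (hs : 0 ≤ s) (hst : s < t) (ht : t ≤ T)
    (hg : IntervalIntegrable g MeasureTheory.volume 0 T)
    (hgK : ∀ r, ‖g r‖ ≤ K) :
    ‖∫ r in s..t, g r‖ / (t - s) ^ α ≤ K ^ α * (∫ r in (0 : ℝ)..T, ‖g r‖) ^ (1 - α) := by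
  have hts : 0 < t - s := sub_pos.mpr hst
  have hLip : ‖∫ r in s..t, g r‖ ≤ K * (t - s) := by
    simpa [abs_of_pos hts] using
      intervalIntegral.norm_integral_le_of_norm_le_const (a := s) (b := t) fun r _ => hgK r
  have hL1 : ‖∫ r in s..t, g r‖ ≤ ∫ r in (0 : ℝ)..T, ‖g r‖ :=
    (intervalIntegral.norm_integral_le_integral_norm hst.le).trans <|
      intervalIntegral.integral_mono_interval hs hst.le ht
        (Eventually.of_forall fun r => norm_nonneg (g r)) hg.norm
  rw [div_le_iff₀ (Real.rpow_pos_of_pos hts α)]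
  calc ‖∫ r in s..t, g r‖
      = ‖∫ r in s..t, g r‖ ^ α * ‖∫ r in s..t, g r‖ ^ (1 - α) := by
        rw [← Real.rpow_add_of_nonneg (norm_nonneg _) hα0 (sub_nonneg.mpr hα1)]
        simp
    _ ≤ (K * (t - s)) ^ α * (∫ r in (0 : ℝ)..T, ‖g r‖) ^ (1 - α) := by
        have := sub_nonneg.mpr hα1
        gcongr
    _ = K ^ α * (∫ r in (0 : ℝ)..T, ‖g r‖) ^ (1 - α) * (t - s) ^ α := by
        rw [Real.mul_rpow hK hts.le]
        ring

/-- Let `1/3 < β < 1/2`, `f : ℝ^d → ℝ^d` bounded continuous, and let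
`Yⁿ, Y : [0,T] → ℝ^d` be continuous with `Yⁿ_r → Y_r` pointwise. Then the
`2β`-Hölder seminorm `sup_{0 ≤ s < t ≤ T} ‖∫_s^t (f(Yⁿ_r) − f(Y_r)) dr‖/(t−s)^{2β}`
tends to `0` as `n → ∞`. -/
theorem stmt_10 (d : ℕ) (hd : 1 ≤ d) (T : ℝ) (hT : 0 < T)
    (β : ℝ) (hβ1 : 1 / 3 < β) (hβ2 : β < 1 / 2)
    (f : EuclideanSpace ℝ (Fin d) → EuclideanSpace ℝ (Fin d))
    (hfc : Continuous f) (hfb : ∃ C, ∀ x, ‖f x‖ ≤ C)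
    (Y : ℝ → EuclideanSpace ℝ (Fin d))
    (Yn : ℕ → ℝ → EuclideanSpace ℝ (Fin d))
    (hY : ContinuousOn Y (Set.Icc 0 T))
    (hYn : ∀ n, ContinuousOn (Yn n) (Set.Icc 0 T))
    (hconv : ∀ r ∈ Set.Icc (0:ℝ) T, Tendsto (fun n => Yn n r) atTop (nhds (Y r))) :
    Tendsto (fun n =>
        ⨆ p : {q : ℝ × ℝ // 0 ≤ q.1 ∧ q.1 < q.2 ∧ q.2 ≤ T},
          ‖∫ r in p.1.1..p.1.2, (f (Yn n r) - f (Y r))‖ / (p.1.2 - p.1.1) ^ (2 * β))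
      atTop (nhds 0) := by
  obtain ⟨C, hC⟩ := hfb
  have hC0 : 0 ≤ C := (norm_nonneg _).trans (hC 0)
  have hbound (n : ℕ) (r : ℝ) : ‖f (Yn n r) - f (Y r)‖ ≤ C + C :=
    (norm_sub_le _ _).trans (add_le_add (hC _) (hC _))
  have hint (n : ℕ) :
      IntervalIntegrable (fun r => f (Yn n r) - f (Y r)) MeasureTheory.volume 0 T := by
    apply ContinuousOn.intervalIntegrable
    rw [Set.uIcc_of_le hT.le]
    exact (hfc.comp_continuousOn (hYn n)).sub (hfc.comp_continuousOn hY)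
  have hL1 : Tendsto (fun n => ∫ r in (0 : ℝ)..T, ‖f (Yn n r) - f (Y r)‖) atTop (nhds 0) := by
    have h := intervalIntegral.tendsto_integral_filter_of_dominated_convergence
      (μ := MeasureTheory.volume) (a := 0) (b := T) (l := atTop)
      (F := fun n r => ‖f (Yn n r) - f (Y r)‖) (f := fun _ => (0 : ℝ)) (fun _ => C + C)
      (Eventually.of_forall fun n => by
        simpa [Set.uIoc_of_le hT.le] using (hint n).1.aestronglyMeasurable.norm)
      (Eventually.of_forall fun n => Eventually.of_forall fun r _ => by
        simpa using hbound n r)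
      intervalIntegrable_const
      (Eventually.of_forall fun r hr => by
        rw [Set.uIoc_of_le hT.le] at hr
        exact tendsto_iff_norm_sub_tendsto_zero.mp
          ((hfc.tendsto _).comp (hconv r (Set.Ioc_subset_Icc_self hr))))
    simpa using h
  have hup : Tendsto (fun n => (C + C) ^ (2 * β) *
      (∫ r in (0 : ℝ)..T, ‖f (Yn n r) - f (Y r)‖) ^ (1 - 2 * β)) atTop (nhds 0) := by
    have hexp : 0 < 1 - 2 * β := by linarith
    simpa [Real.zero_rpow hexp.ne'] using
      (hL1.rpow_const (Or.inr hexp.le)).const_mul ((C + C) ^ (2 * β))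
  refine squeeze_zero (fun n => Real.iSup_nonneg fun p => ?_)
    (fun n => Real.iSup_le (fun p => ?_) ?_) hup
  · exact div_nonneg (norm_nonneg _) (Real.rpow_nonneg (sub_nonneg.mpr p.2.2.1.le) _)
  · exact norm_integral_div_rpow_le (by linarith) (by linarith) (by linarith)
      p.2.1 p.2.2.1 p.2.2.2 (hint n) (hbound n)
  · have := intervalIntegral.integral_nonneg (μ := MeasureTheory.volume) hT.le
      fun r _ => norm_nonneg (f (Yn n r) - f (Y r))
    positivity
end

section
/- Let T > 0, x₀ ∈ ℝ, let f, σ : ℝ → ℝ be continuous with σ(x)² ≥ λ for all x, where λ > 0, let W : [0,∞) → ℝ be continuous, and let X : [0,T] → ℝ be continuous satisfying X_t = x₀ + ∫₀^t f(X_r) dr + W_{Z_t} for all t ∈ [0,T], where Z_t = ∫₀^t σ(X_r)² dr. Let Y : [0,Z_T] → [0,T] denote the inverse of Z and set K_t = X_{Y_t} for t ∈ [0,Z_T]. Then for all t ∈ [0,Z_T], K_t = x₀ + ∫₀^t ( f(K_r) / σ(K_r)² ) dr + W_t, and moreover ∫₀^{Z_t} ( 1 / σ(K_r)² ) dr = t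 for all t ∈ [0,T]; in particular Z, and hence X = K ∘ Z, is uniquely determined by K, f, σ and x₀. -/
/-- Change of variables along the inverse `Y` of the primitive `Z` of a positive continuous
function `a`. No regularity of `g` is needed. -/
theorem integral_comp_inverse_div_eq {T : ℝ} (hT : 0 ≤ T) {a g Y Z : ℝ → ℝ}
    (ha : ContinuousOn a (Set.Icc 0 T)) (hpos : ∀ t ∈ Set.Icc 0 T, 0 < a t)
    (hZ : ∀ t, Z t = ∫ r in (0:ℝ)..t, a r) (hYZ : ∀ t ∈ Set.Icc 0 T, Y (Z t) = t)
    {s : ℝ} (hs : s ∈ Set.Icc 0 T) :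
    (∫ u in (0:ℝ)..Z s, g (Y u) / a (Y u)) = ∫ r in (0:ℝ)..s, g r := by
  set b : ℝ → ℝ := Set.IccExtend hT ((Set.Icc 0 T).domRestrict a) with hb
  have hbc : Continuous b := ha.domRestrict.Icc_extend'
  have hba : ∀ t ∈ Set.Icc 0 T, b t = a t := fun t ht => by
    simp [hb, Set.IccExtend_of_mem hT _ ht]
  have hbpos : ∀ t, 0 < b t := fun t => hpos _ (Set.projIcc 0 T hT t).2
  set V : ℝ → ℝ := fun t => ∫ r in (0:ℝ)..t, b r with hV
  have hVd : ∀ t, HasDerivAt V (b t) t := fun t => hbc.integral_hasStrictDerivAt 0 t |>.hasDerivAt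
  have hVc : Continuous V := continuous_iff_continuousAt.2 fun t => (hVd t).continuousAt
  have hVm : StrictMono V := strictMono_of_deriv_pos fun t => by
    rw [(hVd t).deriv]; exact hbpos t
  have hVZ : ∀ t ∈ Set.Icc 0 T, V t = Z t := fun t ht => by
    rw [hZ]
    refine intervalIntegral.integral_congr fun r hr => hba r ?_
    rw [Set.uIcc_of_le ht.1] at hr
    exact ⟨hr.1, hr.2.trans ht.2⟩
  have hV0 : V 0 = 0 := by simp [hV]
  have hsub : Set.Icc 0 s ⊆ Set.Icc 0 T := Set.Icc_subset_Icc_right hs.2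
  have himg : V '' Set.Icc 0 s = Set.Icc 0 (V s) := by
    conv_rhs => rw [← hV0]
    exact (hVm.monotone.image_Icc_subset).antisymm (intermediate_value_Icc hs.1 hVc.continuousOn)
  have hVs : 0 ≤ V s := hV0 ▸ hVm.monotone hs.1
  rw [← hVZ s hs, intervalIntegral.integral_of_le hVs, intervalIntegral.integral_of_le hs.1,
    ← MeasureTheory.integral_Icc_eq_integral_Ioc, ← MeasureTheory.integral_Icc_eq_integral_Ioc,
    ← himg, MeasureTheory.integral_image_eq_integral_abs_deriv_smul measurableSet_Icc
      (fun t _ => (hVd t).hasDerivWithinAt) hVm.injective.injOn]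
  refine MeasureTheory.setIntegral_congr_fun measurableSet_Icc fun t ht => ?_
  have htT := hsub ht
  have hat := hpos t htT
  simp only [smul_eq_mul]
  rw [hVZ t htT, hYZ t htT, hba t htT, abs_of_pos hat]
  field_simp

/-- Time-change reduction. Let `f, σ : ℝ → ℝ` be continuous with `σ² ≥ λ > 0`,
`W` continuous, and let `X : [0,T] → ℝ` be continuous satisfying
`X_t = x₀ + ∫₀^t f(X_r) dr + W_{Z_t}` where `Z_t = ∫₀^t σ(X_r)² dr`. Let `Y` be
the inverse of `Z` and `K_t = X_{Y_t}`. Then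
`K_t = x₀ + ∫₀^t f(K_r)/σ(K_r)² dr + W_t` on `[0, Z_T]`, and
`∫₀^{Z_t} 1/σ(K_r)² dr = t` on `[0,T]`. -/
theorem stmt_12 (T : ℝ) (hT : 0 < T) (x₀ : ℝ)
    (f σ : ℝ → ℝ) (hf : Continuous f) (hσ : Continuous σ)
    (lam : ℝ) (hlam : 0 < lam) (hell : ∀ x, lam ≤ (σ x) ^ 2)
    (W : ℝ → ℝ) (hW : Continuous W)
    (X : ℝ → ℝ) (hX : ContinuousOn X (Set.Icc 0 T))
    (Z : ℝ → ℝ) (hZ : ∀ t, Z t = ∫ r in (0:ℝ)..t, (σ (X r)) ^ 2)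
    (hXeq : ∀ t ∈ Set.Icc 0 T, X t = x₀ + (∫ r in (0:ℝ)..t, f (X r)) + W (Z t))
    (Y : ℝ → ℝ)
    (hYmaps : Set.MapsTo Y (Set.Icc 0 (Z T)) (Set.Icc 0 T))
    (hYZ : ∀ t ∈ Set.Icc 0 T, Y (Z t) = t)
    (hZY : ∀ u ∈ Set.Icc 0 (Z T), Z (Y u) = u) :
    (∀ t ∈ Set.Icc 0 (Z T),
      X (Y t) = x₀ + (∫ r in (0:ℝ)..t, f (X (Y r)) / (σ (X (Y r))) ^ 2) + W t) ∧
    (∀ t ∈ Set.Icc 0 T, (∫ r in (0:ℝ)..(Z t), 1 / (σ (X (Y r))) ^ 2) = t) := by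
  have ha : ContinuousOn (fun t => (σ (X t)) ^ 2) (Set.Icc 0 T) := (hσ.comp_continuousOn hX).pow 2
  have hpos : ∀ t ∈ Set.Icc 0 T, 0 < (σ (X t)) ^ 2 := fun t _ => hlam.trans_le (hell _)
  refine ⟨fun t ht => ?_, fun t ht => ?_⟩
  · have hsub := integral_comp_inverse_div_eq (g := fun r => f (X r)) hT.le ha hpos hZ hYZ
      (hYmaps ht)
    rw [hZY t ht] at hsub
    rw [hsub, hXeq _ (hYmaps ht), hZY t ht]
  · simpa using integral_comp_inverse_div_eq (g := fun _ => 1) hT.le ha hpos hZ hYZ ht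
end
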